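/- The crawler is strategy-proof on the single-peaked domain: for every preference profile P that is single-peaked with respect to ≺, every endowment profile ω, every agent i, and every strict preference P'_i such that the profile (P'_i, P_{-i}) is also single-peaked with respect to ≺, one has CR_i((P_i, P_{-i}), ω) R_i CR_i((P'_i, P_{-i}), ω). -/

import Mathlib

/- Preferences are given by rank functions: `rk i o` is agent `i`'s rank of object `o`
(lower rank = more preferred), so `o P_i o'` iff `rk i o < rk i o'`. -/

/-- Find the smallest index `t` such that the `t`-th agent prefers the `t`-th object
to the `(t+1)`-st object; the last index always qualifies. -/
def findIdx2 {n : ℕ} (rk : Fin n → Fin n → Fin n) : List (Fin n) → List (Fin n) → ℕ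
  | a :: as, o1 :: o2 :: os =>
      if rk a o1 < rk a o2 then 0 else findIdx2 rk as (o2 :: os) + 1
  | _, _ => 0

/-- One run of the (ascending) crawler: `agents` is the list of remaining agents in the
order of their current ownership, `objects` the list of remaining objects in increasing
`≺`-order (the `t`-th agent currently owns the `t`-th object). -/
def crawlAux {n : ℕ} (rk : Fin n → Fin n → Fin n) :
    ℕ → List (Fin n) → List (Fin n) → List (Fin n × Fin n)
  | 0, _, _ => []
  | fuel + 1, agents, objects =>
    match agents, objects with
    | a0 :: _, o0 :: _ =>
      let t := findIdx2 rk agents objects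
      let a := agents.getD t a0
      let ostar := (objects.argmin (rk a)).getD o0
      (a, ostar) :: crawlAux rk fuel (agents.eraseIdx t) (objects.erase ostar)
    | _, _ => []

/-- Agents listed in increasing order of their endowments. -/
def ownersList {n : ℕ} (ω : Fin n → Fin n) : List (Fin n) :=
  (List.finRange n).filterMap fun o => (List.finRange n).find? fun a => ω a == o

/-- The (ascending) crawler allocation. -/
def CRfun {n : ℕ} (rk : Fin n → Fin n → Fin n) (ω : Fin n → Fin n) (i : Fin n) : Fin n :=
  ((crawlAux rk n (ownersList ω) (List.finRange n)).lookup i).getD (ω i)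

/-- The descending crawler: the mirror image of the ascending crawler, obtained by
reversing the order `≺` on objects. -/
def DCRfun {n : ℕ} (rk : Fin n → Fin n → Fin n) (ω : Fin n → Fin n) (i : Fin n) : Fin n :=
  Fin.rev (CRfun (fun j o => rk j o.rev) (fun j => (ω j).rev) i)

/-- Sequential priority: agents in the given list pick, in order, their most
preferred remaining object. -/
def SPAux {n : ℕ} (rk : Fin n → Fin n → Fin n) :
    List (Fin n) → List (Fin n) → List (Fin n × Fin n)
  | [], _ => []
  | _ :: _, [] => []
  | a :: as, o0 :: os =>
      let o := ((o0 :: os).argmin (rk a)).getD o0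
      (a, o) :: SPAux rk as ((o0 :: os).erase o)

/-- The sequential priority rule induced by the order `f` (agent `f k` has priority `k`). -/
def SPfun {n : ℕ} (rk : Fin n → Fin n → Fin n) (f : Fin n → Fin n) (i : Fin n) : Fin n :=
  ((SPAux rk ((List.finRange n).map f) (List.finRange n)).lookup i).getD i

/-- Top trading cycles: `own` maps each remaining object to its (initial) owner. -/
def TTCAux {n : ℕ} (rk : Fin n → Fin n → Fin n) :
    ℕ → List (Fin n) → List (Fin n) → (Fin n → Fin n) → List (Fin n × Fin n)
  | 0, _, _, _ => []
  | fuel + 1, agents, objects, own =>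
    match agents with
    | [] => []
    | a0 :: _ =>
      let top : Fin n → Fin n := fun a => (objects.argmin (rk a)).getD a0
      let ptr : Fin n → Fin n := fun a => own (top a)
      let onCyc : Fin n → Bool := fun a =>
        (List.range agents.length).any fun k => ptr^[k + 1] a == a
      let cyc := agents.filter onCyc
      let assigned := cyc.map top
      (cyc.map fun a => (a, top a)) ++
        TTCAux rk fuel (agents.filter fun a => !onCyc a)
          (objects.filter fun o => !(assigned.contains o)) own

/-- The top trading cycles allocation from endowments `ω`. -/
def TTCfun {n : ℕ} (rk : Fin n → Fin n → Fin n) (ω : Equiv.Perm (Fin n)) (i : Fin n) : Fin n :=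
  ((TTCAux rk n (List.finRange n) (List.finRange n) ω.symm).lookup i).getD (ω i)

/-- A profile of strict preferences (given as rank permutations) is single-peaked
with respect to the order on `Fin n`. -/
def SinglePeaked {n : ℕ} (P : Fin n → Equiv.Perm (Fin n)) : Prop :=
  ∀ i : Fin n, ∃ p : Fin n, ∀ o o' : Fin n,
    ((o' < o ∧ o ≤ p) ∨ (p ≤ o ∧ o < o')) → P i o < P i o'

/-- Pareto efficiency of an allocation `x` at the profile `P`. -/
def ParetoEfficient {n : ℕ} (P : Fin n → Equiv.Perm (Fin n)) (x : Fin n → Fin n) : Prop :=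
  ¬ ∃ y : Equiv.Perm (Fin n),
      (∀ i, P i (y i) ≤ P i (x i)) ∧ ∃ j, P j (y j) < P j (x j)

/-- A rank function is single-peaked if ranks increase when moving away from some peak. -/
def SinglePeakedRank {n : ℕ} (r : Fin n → Fin n) : Prop :=
  ∃ p : Fin n, ∀ o o' : Fin n, ((o' < o ∧ o ≤ p) ∨ (p ≤ o ∧ o < o')) → r o < r o'

/-- If `o'` is no worse than some `o < o'`, every object up to `o` is no better than `o`. -/
theorem SinglePeakedRank.le_of_le_of_lt {n : ℕ} {r : Fin n → Fin n} (h : SinglePeakedRank r)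
    {o o' y : Fin n} (hlt : o < o') (hr : r o' ≤ r o) (hy : y ≤ o) : r o ≤ r y := by
  obtain ⟨p, hp⟩ := h
  rcases hy.eq_or_lt with rfl | hy
  · exact le_rfl
  rcases le_total o p with hop | hpo
  · exact (hp o y (Or.inl ⟨hy, hop⟩)).le
  · exact absurd (hp o o' (Or.inr ⟨hpo, hlt⟩)) (not_lt.2 hr)

/-- If `o` is better than some `o' > o`, it is better than every object from `o'` on. -/
theorem SinglePeakedRank.lt_of_lt_of_le {n : ℕ} {r : Fin n → Fin n} (h : SinglePeakedRank r)
    {o o' y : Fin n} (hlt : o < o') (hr : r o < r o') (hy : o' ≤ y) : r o < r y := by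
  obtain ⟨p, hp⟩ := h
  rcases hy.eq_or_lt with rfl | hy
  · exact hr
  rcases le_total o' p with hop | hpo
  · exact absurd (hp o' o (Or.inl ⟨hlt, hop⟩)) (not_lt.2 hr.le)
  · exact hr.trans (hp o' y (Or.inr ⟨hpo, hy⟩))

theorem findIdx2_lt_length {n : ℕ} (rk : Fin n → Fin n → Fin n) (A O : List (Fin n))
    (hA : A ≠ []) (hlen : A.length = O.length) : findIdx2 rk A O < A.length := by
  fun_induction findIdx2 rk A O with
  | case1 => simp
  | case2 a as o1 o2 os h ih =>
    have has : as ≠ [] := by rintro rfl; simp at hlen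
    simpa using ih has (by simpa using hlen)
  | case3 => exact List.length_pos_iff.2 hA

theorem le_of_lt_findIdx2 {n : ℕ} (rk : Fin n → Fin n → Fin n) (A O : List (Fin n))
    {s : ℕ} {a o o' : Fin n} (hs : s < findIdx2 rk A O) (ha : A[s]? = some a)
    (ho : O[s]? = some o) (ho' : O[s + 1]? = some o') : rk a o' ≤ rk a o := by
  fun_induction findIdx2 rk A O generalizing s with
  | case1 => simp at hs
  | case2 b as o1 o2 os h ih =>
    cases s with
    | zero => simp_all
    | succ s =>
      exact ih (s := s) (by omega) (by simpa using ha) (by simpa using ho) (by simpa using ho')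
  | case3 => simp at hs

theorem findIdx2_lt {n : ℕ} (rk : Fin n → Fin n → Fin n) (A O : List (Fin n))
    {a o o' : Fin n} (ha : A[findIdx2 rk A O]? = some a)
    (ho : O[findIdx2 rk A O]? = some o) (ho' : O[findIdx2 rk A O + 1]? = some o') :
    rk a o < rk a o' := by
  fun_induction findIdx2 rk A O with
  | case1 => simp_all
  | case2 b as o1 o2 os h ih =>
    exact ih (by simpa using ha) (by simpa using ho) (by simpa using ho')
  | case3 A O h =>
    rcases A with _ | ⟨b, as⟩ <;> rcases O with _ | ⟨o1, _ | ⟨o2, os⟩⟩ <;> simp at ha ho ho'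
    exact absurd rfl (h b as o1 o2 os rfl)

/-- A profile agreeing with `rk` for the agent served under `rk` stops no later than `rk`. -/
theorem findIdx2_le_findIdx2 {n : ℕ} (rk rk' : Fin n → Fin n → Fin n) (A O : List (Fin n))
    (hlen : A.length = O.length) {a : Fin n} (ha : A[findIdx2 rk A O]? = some a)
    (hrk : rk' a = rk a) : findIdx2 rk' A O ≤ findIdx2 rk A O := by
  by_contra! h
  have hA : A ≠ [] := by rintro rfl; simp at ha
  have hlt := findIdx2_lt_length rk' A O hA hlen
  have ho := List.getElem?_eq_getElem (l := O) (i := findIdx2 rk A O) (by omega)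
  have ho' := List.getElem?_eq_getElem (l := O) (i := findIdx2 rk A O + 1) (by omega)
  have h1 := findIdx2_lt rk A O ha ho ho'
  have h2 := le_of_lt_findIdx2 rk' A O h ha ho ho'
  rw [hrk] at h2
  exact absurd h1 (not_lt.2 h2)

/-- One step of the crawler: the agent at the index found takes his best remaining object,
which lies weakly to the left of the object he currently owns. -/
theorem crawlAux_succ {n : ℕ} (rk : Fin n → Fin n → Fin n) (hrk : ∀ j, SinglePeakedRank (rk j))
    (fuel : ℕ) (A O : List (Fin n)) (hlen : A.length = O.length) (hO : O.SortedLT)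
    (hA : A ≠ []) :
    ∃ a b q, A[findIdx2 rk A O]? = some a ∧ O[q]? = some b ∧ q ≤ findIdx2 rk A O ∧
      (∀ o ∈ O, rk a b ≤ rk a o) ∧
      O.argmin (rk a) = some b ∧
      crawlAux rk (fuel + 1) A O =
        (a, b) :: crawlAux rk fuel (A.eraseIdx (findIdx2 rk A O)) (O.eraseIdx q) := by
  have htl := findIdx2_lt_length rk A O hA hlen
  obtain ⟨a0, as, rfl⟩ := List.exists_cons_of_ne_nil hA
  obtain ⟨o0, os, rfl⟩ : ∃ o0 os, O = o0 :: os :=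
    List.exists_cons_of_ne_nil (by rintro rfl; simp at hlen)
  set A := a0 :: as with hAdef
  set O := o0 :: os with hOdef
  set t := findIdx2 rk A O with ht
  have ha : A[t]? = some A[t] := List.getElem?_eq_getElem htl
  obtain ⟨b, hb⟩ : ∃ b, O.argmin (rk A[t]) = some b :=
    Option.ne_none_iff_exists'.1 (List.argmin_eq_none.not.2 (List.cons_ne_nil o0 os))
  have hbO : b ∈ O := List.argmin_mem hb
  have hmin : ∀ o ∈ O, rk A[t] b ≤ rk A[t] o := fun o ho => List.le_of_mem_argmin ho hb
  obtain ⟨q, hq, hqb⟩ := List.getElem_of_mem hbO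
  refine ⟨A[t], b, q, ha, by rw [List.getElem?_eq_getElem hq, hqb], ?_, hmin, hb, ?_⟩
  · by_contra! htq
    have htO : t < O.length := by omega
    have htO' : t + 1 < O.length := by omega
    have h1 := findIdx2_lt rk A O ha (List.getElem?_eq_getElem htO)
      (List.getElem?_eq_getElem htO')
    have h2 : O[t + 1] ≤ b := by
      rw [← hqb]
      exact hO.strictMono_get.monotone (a := ⟨t + 1, htO'⟩) (b := ⟨q, hq⟩) htq
    have h3 : O[t] < O[t + 1] :=
      hO.strictMono_get (a := ⟨t, htO⟩) (b := ⟨t + 1, htO'⟩) (Nat.lt_succ_self t)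
    exact absurd ((hrk _).lt_of_lt_of_le h3 h1 h2) (not_lt.2 (hmin _ (List.getElem_mem htO)))
  · have hgetD : A.getD t a0 = A[t] := by simp [List.getD_eq_getElem?_getD, ha]
    have hidx : O.idxOf b = q := by
      rw [← hqb]
      exact hO.nodup.idxOf_getElem q hq
    have herase : O.erase b = O.eraseIdx q := by
      rw [List.erase_eq_eraseIdx_of_idxOf hidx]
    conv_lhs => rw [hAdef, hOdef, crawlAux]
    simp only [← hAdef, ← hOdef, ← ht, hgetD, hb, Option.getD_some, herase]

/-- Where an agent who is not served ends up after a step, and the object he then owns. -/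
theorem exists_getElem?_eraseIdx {n : ℕ} (r : Fin n → Fin n) (A O : List (Fin n))
    {t q k : ℕ} {i o : Fin n} (hlen : A.length = O.length) (htl : t < A.length) (hqt : q ≤ t)
    (hkt : k ≠ t) (hi : A[k]? = some i) (ho : O[k]? = some o)
    (hshift : ∀ o', k < t → O[k + 1]? = some o' → r o' ≤ r o) :
    ∃ (k' : ℕ) (o' : Fin n), (A.eraseIdx t)[k']? = some i ∧
      (O.eraseIdx q)[k']? = some o' ∧ r o' ≤ r o := by
  rcases lt_or_gt_of_ne hkt with h | h
  · by_cases hkq : k < q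
    · exact ⟨k, o, by rw [List.getElem?_eraseIdx_of_lt h, hi],
        by rw [List.getElem?_eraseIdx_of_lt hkq, ho], le_rfl⟩
    · have hk' : O[k + 1]? = some O[k + 1] := List.getElem?_eq_getElem (by omega)
      exact ⟨k, O[k + 1], by rw [List.getElem?_eraseIdx_of_lt h, hi],
        by rw [List.getElem?_eraseIdx_of_ge (by omega), hk'], hshift _ h hk'⟩
  · obtain ⟨k, rfl⟩ : ∃ m, k = m + 1 := ⟨k - 1, by omega⟩
    exact ⟨k, o, by rw [List.getElem?_eraseIdx_of_ge (by omega), hi],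
      by rw [List.getElem?_eraseIdx_of_ge (by omega), ho], le_rfl⟩

theorem List.SortedLT.eraseIdx {α : Type*} [Preorder α] {O : List α} (hO : O.SortedLT) (q : ℕ) :
    (O.eraseIdx q).SortedLT :=
  (hO.pairwise.sublist (List.eraseIdx_sublist O q)).sortedLT

/-- Individual rationality: every agent gets a remaining object at least as good for him as
the one he currently owns. -/
theorem exists_lookup_crawlAux_le {n : ℕ} (rk : Fin n → Fin n → Fin n)
    (hrk : ∀ j, SinglePeakedRank (rk j)) (fuel : ℕ) (A O : List (Fin n))
    (hlen : A.length = O.length) (hfuel : A.length ≤ fuel) (hA : A.Nodup) (hO : O.SortedLT)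
    {k : ℕ} {i o : Fin n} (hi : A[k]? = some i) (ho : O[k]? = some o) :
    ∃ x ∈ O, (crawlAux rk fuel A O).lookup i = some x ∧ rk i x ≤ rk i o := by
  have hne : A ≠ [] := by rintro rfl; simp at hi
  induction fuel generalizing A O k o with
  | zero => exact absurd (List.length_eq_zero_iff.1 (Nat.le_zero.1 hfuel)) hne
  | succ fuel ih =>
    obtain ⟨a, b, q, ha, hb, hqt, hmin, -, hstep⟩ := crawlAux_succ rk hrk fuel A O hlen hO hne
    have htl := findIdx2_lt_length rk A O hne hlen
    set t := findIdx2 rk A O with ht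
    rw [hstep]
    by_cases hia : i = a
    · subst hia
      exact ⟨b, List.mem_of_getElem? hb, by simp, hmin _ (List.mem_of_getElem? ho)⟩
    · have hkt : k ≠ t := by
        rintro rfl
        exact hia (Option.some.inj (hi.symm.trans ha))
      obtain ⟨k', o', hi', ho', hle⟩ := exists_getElem?_eraseIdx (rk i) A O hlen htl hqt hkt hi ho
        fun o' h h' => le_of_lt_findIdx2 rk A O h hi ho h'
      obtain ⟨x, hx, hlook, hxle⟩ := ih (A.eraseIdx t) (O.eraseIdx q)
        (by rw [List.length_eraseIdx_of_lt htl, List.length_eraseIdx_of_lt (by omega), hlen])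
        (by rw [List.length_eraseIdx_of_lt htl]; omega)
        (hA.sublist (List.eraseIdx_sublist A t)) (hO.eraseIdx q) hi' ho'
        (by rintro h; simp [h] at hi')
      exact ⟨x, List.mem_of_mem_eraseIdx hx,
        by simpa [List.lookup_cons, beq_eq_false_iff_ne.2 hia] using hlook, hxle.trans hle⟩

/-- From any state of the crawler, an agent's truthful outcome is at least as good as the one
he obtains from a unilateral misreport. -/
theorem lookup_crawlAux_le_of_misreport {n : ℕ} (rk rk' : Fin n → Fin n → Fin n)
    (hrk : ∀ j, SinglePeakedRank (rk j)) (hrk' : ∀ j, SinglePeakedRank (rk' j)) (i : Fin n)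
    (hagree : ∀ j, j ≠ i → rk' j = rk j) (fuel : ℕ) (A O : List (Fin n))
    (hlen : A.length = O.length) (hfuel : A.length ≤ fuel) (hA : A.Nodup) (hO : O.SortedLT)
    (hi : i ∈ A) {x y : Fin n} (hx : (crawlAux rk fuel A O).lookup i = some x)
    (hy : (crawlAux rk' fuel A O).lookup i = some y) : rk i x ≤ rk i y := by
  have hne : A ≠ [] := by rintro rfl; simp at hi
  obtain ⟨k, hk⟩ := List.mem_iff_getElem?.1 hi
  have hkl : k < A.length := (List.getElem?_eq_some_iff.1 hk).1
  have hko : O[k]? = some O[k] := List.getElem?_eq_getElem (by omega)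
  induction fuel generalizing A O k with
  | zero => exact absurd (List.length_eq_zero_iff.1 (Nat.le_zero.1 hfuel)) hne
  | succ fuel ih =>
    obtain ⟨x', hx'O, hx', hx'le⟩ :=
      exists_lookup_crawlAux_le rk hrk (fuel + 1) A O hlen hfuel hA hO hk hko
    obtain ⟨y', hy'O, hy', -⟩ :=
      exists_lookup_crawlAux_le rk' hrk' (fuel + 1) A O hlen hfuel hA hO hk hko
    obtain rfl : x' = x := Option.some.inj (hx'.symm.trans hx)
    obtain rfl : y' = y := Option.some.inj (hy'.symm.trans hy)
    obtain ⟨a, b, q, ha, hb, hqt, hmin, harg, hstep⟩ :=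
      crawlAux_succ rk hrk fuel A O hlen hO hne
    obtain ⟨a', b', q', ha', hb', hqt', hmin', harg', hstep'⟩ :=
      crawlAux_succ rk' hrk' fuel A O hlen hO hne
    have htl := findIdx2_lt_length rk A O hne hlen
    have htl' := findIdx2_lt_length rk' A O hne hlen
    by_cases hia : i = a
    · subst hia
      rw [hstep] at hx
      obtain rfl : b = x' := by simpa using hx
      exact hmin _ hy'O
    have hle := findIdx2_le_findIdx2 rk rk' A O hlen ha (hagree a (Ne.symm hia))
    by_cases hia' : i = a'
    · subst hia'
      rw [hstep'] at hy
      obtain rfl : b' = y' := by simpa using hy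
      have hkt' : k = findIdx2 rk' A O :=
        (List.getElem?_inj hkl hA).1 (hk.trans ha'.symm)
      have hkt : k < findIdx2 rk A O := by
        refine lt_of_le_of_ne (hkt' ▸ hle) fun h => hia ?_
        rw [h] at hk
        exact Option.some.inj (hk.symm.trans ha)
      have hk1 : k + 1 < O.length := by omega
      refine hx'le.trans ((hrk i).le_of_le_of_lt (o' := O[k + 1]) ?_
        (le_of_lt_findIdx2 rk A O hkt hk hko (List.getElem?_eq_getElem hk1)) ?_)
      · exact hO.strictMono_get (a := ⟨k, by omega⟩) (b := ⟨k + 1, hk1⟩) (Nat.lt_succ_self k)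
      · obtain ⟨hq', rfl⟩ := List.getElem?_eq_some_iff.1 hb'
        exact hO.strictMono_get.monotone (a := ⟨q', hq'⟩) (b := ⟨k, by omega⟩)
          (hqt'.trans hkt'.ge)
    · have htt : findIdx2 rk' A O = findIdx2 rk A O :=
        le_antisymm hle
          (findIdx2_le_findIdx2 rk' rk A O hlen ha' (hagree a' (Ne.symm hia')).symm)
      rw [htt] at ha' hstep'
      obtain rfl : a = a' := Option.some.inj (ha.symm.trans ha')
      rw [hagree a (Ne.symm hia)] at harg'
      obtain rfl : b = b' := Option.some.inj (harg.symm.trans harg')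
      obtain rfl : q = q' :=
        (List.getElem?_inj (List.getElem?_eq_some_iff.1 hb).1 hO.nodup).1 (hb.trans hb'.symm)
      rw [hstep] at hx
      rw [hstep'] at hy
      set t := findIdx2 rk A O
      obtain ⟨k', -, hk', -, -⟩ := exists_getElem?_eraseIdx (fun _ => i) A O hlen htl hqt
        (by rintro rfl; exact hia (Option.some.inj (hk.symm.trans ha))) hk hko (by simp)
      have hmem := List.mem_of_getElem? hk'
      have hlen' : (A.eraseIdx t).length = (O.eraseIdx q).length := by
        rw [List.length_eraseIdx_of_lt htl, List.length_eraseIdx_of_lt (by omega), hlen]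
      have hkl' := (List.getElem?_eq_some_iff.1 hk').1
      exact ih (A.eraseIdx t) (O.eraseIdx q) hlen'
        (by rw [List.length_eraseIdx_of_lt htl]; omega)
        (hA.sublist (List.eraseIdx_sublist A t)) (hO.eraseIdx q) hmem
        (by simpa [List.lookup_cons, beq_eq_false_iff_ne.2 hia] using hx)
        (by simpa [List.lookup_cons, beq_eq_false_iff_ne.2 hia] using hy)
        (List.ne_nil_of_mem hmem) k' hk' hkl' (List.getElem?_eq_getElem (hlen' ▸ hkl'))

theorem ownersList_eq_map {n : ℕ} (ω : Equiv.Perm (Fin n)) :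
    ownersList ω = (List.finRange n).map ω.symm := by
  have h : (fun o => (List.finRange n).find? fun a => ω a == o) = some ∘ ω.symm := by
    funext o
    have hsome : ((List.finRange n).find? fun a => ω a == o).isSome := by
      simpa using ⟨ω.symm o, by simp⟩
    obtain ⟨a, ha⟩ := Option.isSome_iff_exists.1 hsome
    have := List.find?_some ha
    rw [ha, Function.comp_apply, ← beq_iff_eq.1 this, Equiv.symm_apply_apply]
  rw [ownersList, h, List.filterMap_eq_map]

/-- the crawler is strategy-proof on the single-peaked domain:
no agent can obtain (at his true preferences) a better object by reporting another
single-peaked preference. -/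
theorem crawler_strategy_proof {n : ℕ} (hn : 1 ≤ n)
    (P : Fin n → Equiv.Perm (Fin n)) (hP : SinglePeaked P) (ω : Equiv.Perm (Fin n))
    (i : Fin n) (P' : Equiv.Perm (Fin n))
    (hP' : SinglePeaked (Function.update P i P')) :
    P i (CRfun (fun j => ⇑(P j)) ⇑ω i) ≤
      P i (CRfun (fun j => ⇑(Function.update P i P' j)) ⇑ω i) := by
  have hsp := fun j => (hP j : SinglePeakedRank (P j))
  have hsp' := fun j => (hP' j : SinglePeakedRank (Function.update P i P' j))
  have hlen : (ownersList ω).length = (List.finRange n).length := by simp [ownersList_eq_map]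
  have hfuel : (ownersList ω).length ≤ n := by simp [ownersList_eq_map]
  have hA : (ownersList ω).Nodup := by
    rw [ownersList_eq_map]
    exact (List.nodup_finRange n).map ω.symm.injective
  have hO : (List.finRange n).SortedLT := List.sortedLT_finRange n
  have hi : i ∈ ownersList ω := by
    rw [ownersList_eq_map, List.mem_map]
    exact ⟨ω i, List.mem_finRange _, by simp⟩
  obtain ⟨k, hk⟩ := List.mem_iff_getElem?.1 hi
  have hkl : k < (List.finRange n).length := hlen ▸ (List.getElem?_eq_some_iff.1 hk).1
  have hko := List.getElem?_eq_getElem hkl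
  obtain ⟨x, -, hx, -⟩ :=
    exists_lookup_crawlAux_le _ hsp n _ _ hlen hfuel hA hO hk hko
  obtain ⟨y, -, hy, -⟩ :=
    exists_lookup_crawlAux_le _ hsp' n _ _ hlen hfuel hA hO hk hko
  rw [CRfun, CRfun, hx, hy]
  exact lookup_crawlAux_le_of_misreport _ _ hsp hsp' i
    (fun j hj => by rw [Function.update_of_ne hj]) n _ _ hlen hfuel hA hO hi hx hy
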